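/- Let G be a finite simple graph, let 𝒮 = {N[v] : v is a simplicial vertex of G} be the set of distinct simplicial cliques of G, and let W be the union of all cliques in 𝒮. Then α(G) = α(G − W) + |𝒮|, where G − W denotes the subgraph of G induced by V(G) ∖ W. -/

import Mathlib

def IsIndepFinset {V : Type*} (G : SimpleGraph V) (s : Finset V) : Prop :=
  (s : Set V).Pairwise fun u v => ¬ G.Adj u v

/-- `graphAlpha G` is the maximum size of an independent set of `G`. -/
noncomputable def graphAlpha {V : Type*} [Fintype V] (G : SimpleGraph V) : ℕ :=
  sSup {n | ∃ s : Finset V, IsIndepFinset G s ∧ s.card = n}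

/-- A vertex is simplicial if its closed neighborhood `N[v] = {v} ∪ N(v)` is a clique. -/
def IsSimplicialVtx {V : Type*} (G : SimpleGraph V) (v : V) : Prop :=
  G.IsClique (insert v (G.neighborSet v))

open scoped Classical in
/-- The set `𝒮 = {N[v] : v a simplicial vertex of G}` of distinct simplicial cliques. -/
noncomputable def simplicialCliques {V : Type*} [Fintype V] (G : SimpleGraph V) :
    Finset (Finset V) :=
  (Finset.univ.filter fun v => IsSimplicialVtx G v).image
    fun v => insert v (G.neighborFinset v)

theorem isIndepFinset_iff {V : Type*} {G : SimpleGraph V} {s : Finset V} :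
    IsIndepFinset G s ↔ ∀ u ∈ s, ∀ v ∈ s, ¬ G.Adj u v := by
  refine ⟨fun h u hu v hv huv => h hu hv huv.ne huv, fun h u hu v hv _ => h u hu v hv⟩

theorem bddAbove_card_isIndepFinset {V : Type*} [Fintype V] (G : SimpleGraph V) :
    BddAbove {n | ∃ s : Finset V, IsIndepFinset G s ∧ s.card = n} :=
  ⟨Fintype.card V, by rintro _ ⟨s, -, rfl⟩; exact s.card_le_univ⟩

theorem IsIndepFinset.card_le_graphAlpha {V : Type*} [Fintype V] {G : SimpleGraph V}
    {s : Finset V} (hs : IsIndepFinset G s) : s.card ≤ graphAlpha G :=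
  le_csSup (bddAbove_card_isIndepFinset G) ⟨s, hs, rfl⟩

theorem exists_isIndepFinset_card_eq_graphAlpha {V : Type*} [Fintype V] (G : SimpleGraph V) :
    ∃ s : Finset V, IsIndepFinset G s ∧ s.card = graphAlpha G :=
  Nat.sSup_mem (s := {n | ∃ s : Finset V, IsIndepFinset G s ∧ s.card = n})
    ⟨0, ∅, by simp [IsIndepFinset], rfl⟩ (bddAbove_card_isIndepFinset G)

theorem exists_of_mem_simplicialCliques {V : Type*} [Fintype V] {G : SimpleGraph V}
    {K : Finset V} (hK : K ∈ simplicialCliques G) :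
    ∃ v, ∀ u, u ∈ K ↔ u = v ∨ G.Adj v u := by
  simp only [simplicialCliques, Finset.mem_image] at hK
  obtain ⟨v, -, rfl⟩ := hK
  exact ⟨v, by simp⟩

theorem isClique_of_mem_simplicialCliques {V : Type*} [Fintype V] {G : SimpleGraph V}
    {K : Finset V} (hK : K ∈ simplicialCliques G) : G.IsClique (K : Set V) := by
  simp only [simplicialCliques, Finset.mem_image, Finset.mem_filter] at hK
  obtain ⟨v, ⟨-, hv⟩, rfl⟩ := hK
  simpa [IsSimplicialVtx] using hv

open scoped Classical in
theorem IsIndepFinset.card_filter_mem_simplicialCliques_le {V : Type*} [Fintype V]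
    {G : SimpleGraph V} {s : Finset V} (hs : IsIndepFinset G s) :
    (s.filter fun x => ∃ K ∈ simplicialCliques G, x ∈ K).card ≤ (simplicialCliques G).card := by
  refine Finset.card_le_card_of_forall_subsingleton (fun x K => x ∈ K)
    (fun x hx => (Finset.mem_filter.1 hx).2) fun K hK x hx y hy => ?_
  by_contra hxy
  exact hs (Finset.mem_filter.1 hx.1).1 (Finset.mem_filter.1 hy.1).1 hxy
    (isClique_of_mem_simplicialCliques hK hx.2 hy.2 hxy)

open scoped Classical in
/-- Deleting the simplicial cliques lowers `α` by at most their number. -/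
theorem graphAlpha_le_induce_add_card_simplicialCliques {V : Type*} [Fintype V]
    (G : SimpleGraph V) (T : Set V) [Fintype T]
    (hT : ∀ x, x ∈ T ↔ ∀ K ∈ simplicialCliques G, x ∉ K) :
    graphAlpha G ≤ graphAlpha (G.induce T) + (simplicialCliques G).card := by
  obtain ⟨s, hs, hcard⟩ := exists_isIndepFinset_card_eq_graphAlpha G
  have hsub : IsIndepFinset (G.induce T) (s.subtype (· ∈ T)) := by
    rw [isIndepFinset_iff] at hs ⊢
    intro u hu v hv
    exact hs u (Finset.mem_subtype.1 hu) v (Finset.mem_subtype.1 hv)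
  have h₁ := hsub.card_le_graphAlpha
  rw [Finset.card_subtype] at h₁
  have h₂ := hs.card_filter_mem_simplicialCliques_le
  have h₃ := Finset.card_filter_add_card_filter_not (s := s) (· ∈ T)
  have h₄ : s.filter (fun x => x ∉ T) =
      s.filter fun x => ∃ K ∈ simplicialCliques G, x ∈ K :=
    Finset.filter_congr fun x _ => by simp [hT]
  rw [h₄] at h₃
  omega

open scoped Classical in
/-- Choosing one simplicial vertex per simplicial clique extends any independent set that avoids
these cliques. -/
theorem induce_add_card_simplicialCliques_le_graphAlpha {V : Type*} [Fintype V]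
    (G : SimpleGraph V) (T : Set V) [Fintype T]
    (hT : ∀ x, x ∈ T ↔ ∀ K ∈ simplicialCliques G, x ∉ K) :
    graphAlpha (G.induce T) + (simplicialCliques G).card ≤ graphAlpha G := by
  obtain ⟨t, ht, hcard⟩ := exists_isIndepFinset_card_eq_graphAlpha (G.induce T)
  cases isEmpty_or_nonempty V
  · have hS : simplicialCliques G = ∅ := Finset.eq_empty_of_forall_notMem fun K hK =>
      isEmptyElim (exists_of_mem_simplicialCliques hK).choose
    simp [← hcard, hS, Finset.eq_empty_of_isEmpty t]
  choose! f hf using fun K (hK : K ∈ simplicialCliques G) => exists_of_mem_simplicialCliques hK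
  have hsub : ∀ K ∈ simplicialCliques G, ∀ L ∈ simplicialCliques G, f L ∈ K → K ⊆ L := by
    intro K hK L hL h x hx
    rw [hf L hL]
    by_cases hxL : x = f L
    · exact Or.inl hxL
    · exact Or.inr (isClique_of_mem_simplicialCliques hK h hx (Ne.symm hxL))
  have hself : ∀ K ∈ simplicialCliques G, f K ∈ K := fun K hK => (hf K hK _).2 (Or.inl rfl)
  have hinj : Set.InjOn f (simplicialCliques G : Set (Finset V)) := fun K hK L hL h =>
    (hsub K hK L hL (h ▸ hself K hK)).antisymm (hsub L hL K hK (h ▸ hself L hL))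
  have hdisj : Disjoint (t.map (Function.Embedding.subtype (· ∈ T)))
      ((simplicialCliques G).image f) := by
    rw [Finset.disjoint_left]
    intro x hx hx'
    obtain ⟨y, -, rfl⟩ := Finset.mem_map.1 hx
    obtain ⟨K, hK, h⟩ := Finset.mem_image.1 hx'
    refine (hT y).1 y.2 K hK ?_
    rw [show (y : V) = f K from h.symm]
    exact hself K hK
  have hout : ∀ y : T, ∀ K ∈ simplicialCliques G, ¬ G.Adj (f K) y := fun y K hK h =>
    (hT y).1 y.2 K hK ((hf K hK y).2 (Or.inr h))
  have hindep : IsIndepFinset G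
      (t.map (Function.Embedding.subtype (· ∈ T)) ∪ (simplicialCliques G).image f) := by
    rw [isIndepFinset_iff] at ht ⊢
    intro u hu v hv huv
    rw [Finset.mem_union, Finset.mem_map, Finset.mem_image] at hu hv
    obtain ⟨y, hy, rfl⟩ | ⟨K, hK, rfl⟩ := hu <;> obtain ⟨z, hz, rfl⟩ | ⟨L, hL, rfl⟩ := hv
    · exact ht y hy z hz huv
    · exact hout y L hL huv.symm
    · exact hout z K hK huv
    · have hKL : K = L :=
        (hsub K hK L hL ((hf K hK _).2 (Or.inr huv))).antisymm
          (hsub L hL K hK ((hf L hL _).2 (Or.inr huv.symm)))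
      exact huv.ne (congrArg f hKL)
  have h := hindep.card_le_graphAlpha
  rwa [Finset.card_union_of_disjoint hdisj, Finset.card_map, Finset.card_image_of_injOn hinj,
    hcard] at h

open scoped Classical in
/-- With `𝒮` the set of distinct simplicial cliques of `G` and `W` the union
of all cliques in `𝒮`, one has `α(G) = α(G - W) + |𝒮|`, where `G - W` is the subgraph of
`G` induced by `V(G) ∖ W`. -/
theorem alpha_eq_alpha_minus_simplicial {V : Type*} [Fintype V] [DecidableEq V]
    (G : SimpleGraph V) :
    graphAlpha G =
      graphAlpha (G.induce ((((simplicialCliques G).sup id)ᶜ : Finset V) : Set V)) +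
        (simplicialCliques G).card := by
  have hT : ∀ x, x ∈ ((((simplicialCliques G).sup id)ᶜ : Finset V) : Set V) ↔
      ∀ K ∈ simplicialCliques G, x ∉ K := by
    intro x
    rw [Finset.mem_coe, Finset.mem_compl, Finset.mem_sup]
    simp
  exact (graphAlpha_le_induce_add_card_simplicialCliques G _ hT).antisymm
    (induce_add_card_simplicialCliques_le_graphAlpha G _ hT)
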